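/- arXiv:2002.09432 — 3 statements merged into one kernel-verified Lean document; each statement's English description precedes it below -/
import Mathlib

section
/- Let U be a nonsingular nonnegative real n×n matrix with all row sums and all column sums positive. Let D be the diagonal matrix with D_{ii} = (Σ_j U_{ij})⁻¹ and E the diagonal matrix with E_{ii} = (Σ_j U_{ji})⁻¹. Then U⁻¹ is an M-matrix if and only if DUE is a double potential. -/
open Matrix Finset

/-- A nonnegative nonsingular matrix `W` is a potential if `N = W⁻¹` satisfies
`N i j ≤ 0` for `i ≠ j`, `N i i > 0`, and row diagonal dominance. -/
def IsPotential {n : ℕ} (W : Matrix (Fin n) (Fin n) ℝ) : Prop :=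
  (∀ i j, 0 ≤ W i j) ∧ IsUnit W.det ∧
    (∀ i j, i ≠ j → W⁻¹ i j ≤ 0) ∧ (∀ i, 0 < W⁻¹ i i) ∧
    (∀ i, ∑ j ∈ Finset.univ.erase i, |W⁻¹ i j| ≤ W⁻¹ i i)

/-- `W` is a double potential if both `W` and `Wᵀ` are potentials. -/
def IsDoublePotential {n : ℕ} (W : Matrix (Fin n) (Fin n) ℝ) : Prop :=
  IsPotential W ∧ IsPotential Wᵀ

/-- A nonsingular matrix `M` is an M-matrix if its off-diagonal entries are
nonpositive and its inverse is nonnegative. -/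
def IsMMatrix {n : ℕ} (M : Matrix (Fin n) (Fin n) ℝ) : Prop :=
  IsUnit M.det ∧ (∀ i j, i ≠ j → M i j ≤ 0) ∧ (∀ i j, 0 ≤ M⁻¹ i j)

/-- A nonnegative nonsingular matrix whose inverse has nonpositive off-diagonal entries and
positive row sums is a potential. -/
theorem isPotential_of_sum_inv_pos {n : ℕ} {W : Matrix (Fin n) (Fin n) ℝ}
    (hW : ∀ i j, 0 ≤ W i j) (hdet : IsUnit W.det) (hoff : ∀ i j, i ≠ j → W⁻¹ i j ≤ 0)
    (hsum : ∀ i, 0 < ∑ j, W⁻¹ i j) : IsPotential W := by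
  have hdom : ∀ i, ∑ j ∈ Finset.univ.erase i, |W⁻¹ i j| < W⁻¹ i i := by
    intro i
    have habs : ∑ j ∈ Finset.univ.erase i, |W⁻¹ i j|
        = -∑ j ∈ Finset.univ.erase i, W⁻¹ i j := by
      rw [← Finset.sum_neg_distrib]
      exact Finset.sum_congr rfl fun j hj =>
        abs_of_nonpos (hoff i j (Finset.ne_of_mem_erase hj).symm)
    have hsplit := Finset.add_sum_erase Finset.univ (fun j => W⁻¹ i j) (Finset.mem_univ i)
    have hpos := hsum i
    rw [habs]
    linarith
  exact ⟨hW, hdet, hoff,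
    fun i => (Finset.sum_nonneg fun j _ => abs_nonneg (W⁻¹ i j)).trans_lt (hdom i),
    fun i => (hdom i).le⟩

/-- Entries of the inverse of a matrix with rescaled rows and columns. -/
theorem inv_diagonal_mul_mul_diagonal_apply {n : ℕ} {U : Matrix (Fin n) (Fin n) ℝ}
    (hU : IsUnit U.det) {r c : Fin n → ℝ} (hr : ∀ i, r i ≠ 0) (hc : ∀ i, c i ≠ 0)
    (i j : Fin n) :
    (diagonal (fun i => (r i)⁻¹) * U * diagonal (fun i => (c i)⁻¹))⁻¹ i j
      = c i * U⁻¹ i j * r j := by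
  have hinv : (diagonal (fun i => (r i)⁻¹) * U * diagonal (fun i => (c i)⁻¹))⁻¹
      = diagonal c * U⁻¹ * diagonal r := by
    apply Matrix.inv_eq_right_inv
    have hcc : diagonal (fun i => (c i)⁻¹) * diagonal c = 1 := by simp [hc]
    have hrr : diagonal (fun i => (r i)⁻¹) * diagonal r = 1 := by simp [hr]
    calc _ = diagonal (fun i => (r i)⁻¹) * (U * (diagonal (fun i => (c i)⁻¹) * diagonal c)
              * U⁻¹) * diagonal r := by simp only [Matrix.mul_assoc]
      _ = 1 := by rw [hcc, Matrix.mul_one, Matrix.mul_nonsing_inv U hU, Matrix.mul_one, hrr]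
  rw [hinv, Matrix.mul_diagonal, Matrix.diagonal_mul]

/-- Normalising the rows of a nonnegative matrix by their sums, and its columns by arbitrary
positive factors, yields a potential as soon as the inverse has nonpositive off-diagonal
entries. -/
theorem isPotential_normalize {n : ℕ} {U : Matrix (Fin n) (Fin n) ℝ}
    (hU : ∀ i j, 0 ≤ U i j) (hns : IsUnit U.det) (hoff : ∀ i j, i ≠ j → U⁻¹ i j ≤ 0)
    (hrow : ∀ i, 0 < ∑ j, U i j) {c : Fin n → ℝ} (hc : ∀ i, 0 < c i) :
    IsPotential (diagonal (fun i => (∑ j, U i j)⁻¹) * U * diagonal (fun i => (c i)⁻¹)) := by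
  have happ := inv_diagonal_mul_mul_diagonal_apply hns
    (fun i => (hrow i).ne') (fun i => (hc i).ne')
  apply isPotential_of_sum_inv_pos
  · intro i j
    rw [Matrix.mul_diagonal, Matrix.diagonal_mul]
    exact mul_nonneg (mul_nonneg (inv_nonneg.2 (hrow i).le) (hU i j)) (inv_nonneg.2 (hc j).le)
  · rw [Matrix.det_mul, Matrix.det_mul, Matrix.det_diagonal, Matrix.det_diagonal]
    refine ((IsUnit.mk0 _ ?_).mul hns).mul (IsUnit.mk0 _ ?_)
    · exact Finset.prod_ne_zero_iff.2 fun i _ => inv_ne_zero (hrow i).ne'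
    · exact Finset.prod_ne_zero_iff.2 fun i _ => inv_ne_zero (hc i).ne'
  · intro i j hij
    rw [happ]
    exact mul_nonpos_of_nonpos_of_nonneg
      (mul_nonpos_of_nonneg_of_nonpos (hc i).le (hoff i j hij)) (hrow j).le
  · intro i
    have hone : ∑ j, U⁻¹ i j * ∑ k, U j k = 1 := by
      have hmv : U⁻¹ *ᵥ (U *ᵥ 1) = 1 := by
        rw [Matrix.mulVec_mulVec, Matrix.nonsing_inv_mul U hns, Matrix.one_mulVec]
      simpa [Matrix.mulVec, dotProduct] using congrFun hmv i
    simp_rw [happ, mul_assoc]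
    rw [← Finset.mul_sum, hone, mul_one]
    exact hc i

/-- `U⁻¹` is an M-matrix iff `DUE` is a double potential, where `D` (resp. `E`)
is the diagonal matrix of reciprocals of row (resp. column) sums of `U`. -/
theorem stmt_4 {n : ℕ} (U : Matrix (Fin n) (Fin n) ℝ)
    (hU : ∀ i j, 0 ≤ U i j) (hns : IsUnit U.det)
    (hrow : ∀ i, 0 < ∑ j, U i j) (hcol : ∀ i, 0 < ∑ j, U j i)
    (D E : Matrix (Fin n) (Fin n) ℝ)
    (hD : D = Matrix.diagonal fun i => (∑ j, U i j)⁻¹)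
    (hE : E = Matrix.diagonal fun i => (∑ j, U j i)⁻¹) :
    IsMMatrix U⁻¹ ↔ IsDoublePotential (D * U * E) := by
  subst hD hE
  constructor
  · rintro ⟨-, hoff, -⟩
    refine ⟨isPotential_normalize hU hns hoff hrow hcol, ?_⟩
    rw [Matrix.transpose_mul, Matrix.transpose_mul, Matrix.diagonal_transpose,
      Matrix.diagonal_transpose, ← Matrix.mul_assoc]
    refine isPotential_normalize (U := Uᵀ) (fun i j => hU j i) ?_ ?_ hcol hrow
    · rwa [Matrix.det_transpose]
    · intro i j hij
      rw [← Matrix.transpose_nonsing_inv]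
      exact hoff j i hij.symm
  · rintro ⟨⟨-, -, hoff, -, -⟩, -⟩
    refine ⟨U.isUnit_nonsing_inv_det hns, fun i j hij => ?_, fun i j => ?_⟩
    · have h := hoff i j hij
      rw [inv_diagonal_mul_mul_diagonal_apply hns
        (fun i => (hrow i).ne') (fun i => (hcol i).ne')] at h
      exact nonpos_of_mul_nonpos_right (nonpos_of_mul_nonpos_left h (hrow j)) (hcol i)
    · rw [Matrix.nonsing_inv_nonsing_inv U hns]
      exact hU i j
end

section
/- Let U be a nonsingular nonnegative real n×n matrix with all column sums positive, and let E be the diagonal matrix with E_{ii} = (Σ_j U_{ji})⁻¹. Then U is a potential if and only if UE is a double potential. -/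
open Matrix Finset

/-- Scaling the columns of a potential by positive factors yields a potential. -/
theorem IsPotential.mul_diagonal {n : ℕ} {W : Matrix (Fin n) (Fin n) ℝ} (hW : IsPotential W)
    {d : Fin n → ℝ} (hd : ∀ i, 0 < d i) : IsPotential (W * Matrix.diagonal d) := by
  obtain ⟨hnonneg, hdet, hoff, hdiag, hdom⟩ := hW
  have hdiagonal : (Matrix.diagonal d)⁻¹ = Matrix.diagonal fun i => (d i)⁻¹ := by
    refine Matrix.inv_eq_left_inv ?_
    rw [Matrix.diagonal_mul_diagonal, ← Matrix.diagonal_one]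
    congr 1
    funext i
    exact inv_mul_cancel₀ (hd i).ne'
  have hinv : ∀ i j, (W * Matrix.diagonal d)⁻¹ i j = (d i)⁻¹ * W⁻¹ i j := by
    intro i j
    rw [Matrix.mul_inv_rev, hdiagonal, Matrix.diagonal_mul]
  have hd' : ∀ i, 0 < (d i)⁻¹ := fun i => inv_pos.2 (hd i)
  refine ⟨fun i j => ?_, ?_, fun i j hij => ?_, fun i => ?_, fun i => ?_⟩
  · rw [Matrix.mul_diagonal]
    exact mul_nonneg (hnonneg i j) (hd j).le
  · rw [Matrix.det_mul, Matrix.det_diagonal]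
    exact hdet.mul (Finset.prod_pos fun i _ => hd i).ne'.isUnit
  · rw [hinv]
    exact mul_nonpos_of_nonneg_of_nonpos (hd' i).le (hoff i j hij)
  · rw [hinv]
    exact mul_pos (hd' i) (hdiag i)
  · simp only [hinv, abs_mul, abs_of_pos (hd' i), ← Finset.mul_sum]
    exact mul_le_mul_of_nonneg_left (hdom i) (hd' i).le

/-- A potential whose columns all sum to `1` is a double potential. -/
theorem IsPotential.isDoublePotential_of_vecMul_one {n : ℕ} {W : Matrix (Fin n) (Fin n) ℝ}
    (hW : IsPotential W) (hsum : (1 : Fin n → ℝ) ᵥ* W = 1) : IsDoublePotential W := by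
  refine ⟨hW, ?_⟩
  obtain ⟨hnonneg, hdet, hoff, hdiag, -⟩ := hW
  have hinv : (1 : Fin n → ℝ) ᵥ* W⁻¹ = 1 := by
    nth_rewrite 1 [← hsum]
    rw [Matrix.vecMul_vecMul, Matrix.mul_nonsing_inv _ hdet, Matrix.vecMul_one]
  refine ⟨fun i j => hnonneg j i, by rwa [Matrix.det_transpose], ?_, ?_, ?_⟩
  all_goals simp only [← Matrix.transpose_nonsing_inv, Matrix.transpose_apply]
  · exact fun i j hij => hoff j i hij.symm
  · exact hdiag
  · intro i
    have hcol : ∑ j, W⁻¹ j i = 1 := by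
      simpa [Matrix.vecMul, dotProduct] using congrFun hinv i
    rw [← Finset.add_sum_erase _ _ (Finset.mem_univ i)] at hcol
    have habs : ∑ j ∈ Finset.univ.erase i, |W⁻¹ j i| =
        -∑ j ∈ Finset.univ.erase i, W⁻¹ j i := by
      rw [← Finset.sum_neg_distrib]
      exact Finset.sum_congr rfl fun j hj =>
        abs_of_nonpos (hoff j i (Finset.ne_of_mem_erase hj))
    linarith

/-- `U` is a potential iff `UE` is a double potential, where `E` is the
diagonal matrix of reciprocals of column sums of `U`. -/
theorem stmt_6 {n : ℕ} (U : Matrix (Fin n) (Fin n) ℝ)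
    (hU : ∀ i j, 0 ≤ U i j) (hns : IsUnit U.det)
    (hcol : ∀ i, 0 < ∑ j, U j i)
    (E : Matrix (Fin n) (Fin n) ℝ)
    (hE : E = Matrix.diagonal fun i => (∑ j, U j i)⁻¹) :
    IsPotential U ↔ IsDoublePotential (U * E) := by
  subst hE
  constructor
  · intro h
    refine (h.mul_diagonal fun i => inv_pos.2 (hcol i)).isDoublePotential_of_vecMul_one ?_
    funext i
    simp only [Matrix.vecMul, dotProduct, Pi.one_apply, one_mul, Matrix.mul_diagonal]
    rw [← Finset.sum_mul, mul_inv_cancel₀ (hcol i).ne']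
  · rintro ⟨h, -⟩
    convert h.mul_diagonal hcol
    ext i j
    rw [Matrix.mul_diagonal, Matrix.mul_diagonal, inv_mul_cancel_right₀ (hcol j).ne']
end

section
/- Let U be a nonsingular nonnegative real n×n matrix with all column sums positive, and let E be the diagonal matrix with E_{ii} = (Σ_j U_{ji})⁻¹. Then U is a potential if and only if for every x ∈ ℝⁿ one has ⟨(Ux − 𝟙)⁺, E⁻¹ x⟩ ≥ 0. -/
open Matrix Finset

theorem sum_max_sub_one_mul_mulVec_nonneg {n : ℕ} (M : Matrix (Fin n) (Fin n) ℝ)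
    (hoff : ∀ i j, i ≠ j → M i j ≤ 0) (hrow : ∀ i, 0 ≤ ∑ j, M i j)
    (hcol : ∀ j, 0 ≤ ∑ i, M i j) (y : Fin n → ℝ) :
    0 ≤ ∑ i, max (y i - 1) 0 * M.mulVec y i := by
  set z : Fin n → ℝ := fun i => max (y i - 1) 0 with hz
  have hz0 : ∀ i, 0 ≤ z i := fun i => le_max_right _ _
  have hzy : ∀ i, y i ≤ z i + 1 := fun i => by
    have := le_max_left (y i - 1) 0
    simp only [hz]; linarith
  have hpt : ∀ i j, (z i ^ 2 / 2 + z i) * M i j + z j ^ 2 / 2 * M i j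
      ≤ z i * (M i j * y j) := by
    intro i j
    by_cases hij : i = j
    · subst hij
      have : z i * y i = z i ^ 2 + z i := by
        simp only [hz]
        rcases le_total (y i - 1) 0 with h | h
        · rw [max_eq_right h]; ring
        · rw [max_eq_left h]; ring
      apply le_of_eq
      linear_combination (-M i i) * this
    · have h1 := mul_nonneg (mul_nonneg (neg_nonneg.2 (hoff i j hij)) (hz0 i))
        (sub_nonneg.2 (hzy j))
      have h2 := mul_nonneg (neg_nonneg.2 (hoff i j hij)) (sq_nonneg (z i - z j))
      nlinarith
  have hsum : ∑ i, ∑ j, ((z i ^ 2 / 2 + z i) * M i j + z j ^ 2 / 2 * M i j)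
      ≤ ∑ i, z i * M.mulVec y i := by
    refine Finset.sum_le_sum fun i _ => ?_
    rw [Matrix.mulVec, dotProduct, Finset.mul_sum]
    exact Finset.sum_le_sum fun j _ => hpt i j
  refine le_trans ?_ hsum
  simp only [Finset.sum_add_distrib]
  rw [Finset.sum_comm (f := fun i j => z j ^ 2 / 2 * M i j)]
  simp only [← Finset.mul_sum]
  refine add_nonneg (Finset.sum_nonneg fun i _ => mul_nonneg ?_ (hrow i))
    (Finset.sum_nonneg fun j _ => mul_nonneg (by positivity) (hcol j))
  have := hz0 i
  positivity

theorem row_sum_add_mul_diag_nonneg {n : ℕ} (M : Matrix (Fin n) (Fin n) ℝ)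
    (h : ∀ y : Fin n → ℝ, 0 ≤ ∑ i, max (y i - 1) 0 * M.mulVec y i)
    {i : Fin n} {t : ℝ} (ht : 0 < t) {v : Fin n → ℝ} (hv : ∀ k, 0 ≤ v k) (hvi : v i = 0) :
    0 ≤ ∑ k, M i k + t * M i i - M.mulVec v i := by
  have h1 := h (1 + Pi.single i t - v)
  rw [Finset.sum_eq_single i] at h1
  · have h2 : max ((1 + Pi.single i t - v : Fin n → ℝ) i - 1) 0 = t := by
      simp [hvi, ht.le]
    rw [h2] at h1
    have h3 := nonneg_of_mul_nonneg_right h1 ht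
    rw [Matrix.mulVec_sub, Matrix.mulVec_add, Pi.sub_apply, Pi.add_apply,
      Matrix.mulVec_single] at h3
    simpa [Matrix.mulVec, dotProduct, mul_comm] using h3
  · intro k _ hk
    have : max ((1 + Pi.single i t - v : Fin n → ℝ) k - 1) 0 = 0 := by
      simp [hk, hv k]
    rw [this, zero_mul]
  · simp

theorem row_sum_nonneg_of_forall_sum_nonneg {n : ℕ} (M : Matrix (Fin n) (Fin n) ℝ)
    (h : ∀ y : Fin n → ℝ, 0 ≤ ∑ i, max (y i - 1) 0 * M.mulVec y i) (i : Fin n) :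
    0 ≤ ∑ k, M i k := by
  by_contra! hneg
  have hpos : 0 < |M i i| + 1 := by positivity
  have ht : 0 < -(∑ k, M i k) / (|M i i| + 1) := div_pos (neg_pos.2 hneg) hpos
  have h1 := row_sum_add_mul_diag_nonneg M h (i := i) ht (v := 0) (by simp) rfl
  have h2 : -(∑ k, M i k) / (|M i i| + 1) * (|M i i| + 1) = -(∑ k, M i k) :=
    div_mul_cancel₀ _ hpos.ne'
  have h3 := mul_le_mul_of_nonneg_left (le_abs_self (M i i)) ht.le
  simp only [Matrix.mulVec_zero, Pi.zero_apply] at h1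
  linarith

theorem offDiag_nonpos_of_forall_sum_nonneg {n : ℕ} (M : Matrix (Fin n) (Fin n) ℝ)
    (h : ∀ y : Fin n → ℝ, 0 ≤ ∑ i, max (y i - 1) 0 * M.mulVec y i) (i j : Fin n)
    (hij : i ≠ j) : M i j ≤ 0 := by
  by_contra! hpos
  set a := ∑ k, M i k + 1 * M i i
  have hs : 0 ≤ (|a| + 1) / M i j := by positivity
  have h1 := row_sum_add_mul_diag_nonneg M h (i := i) one_pos
    (v := Pi.single j ((|a| + 1) / M i j))
    (fun k => by rw [Pi.single_apply]; split_ifs <;> simp [hs]) (by simp [hij])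
  have h2 : M.mulVec (Pi.single j ((|a| + 1) / M i j)) i = |a| + 1 := by
    rw [Matrix.mulVec_single]
    simp only [Pi.smul_apply, Matrix.col_apply, MulOpposite.smul_eq_mul_unop,
      MulOpposite.unop_op]
    exact mul_div_cancel₀ _ hpos.ne'
  rw [h2] at h1
  have := le_abs_self a
  linarith

/-- `U` is a potential iff `⟨(Ux − 𝟙)⁺, E⁻¹x⟩ ≥ 0` for all `x`, where `E`
is the diagonal matrix of reciprocals of column sums of `U`. -/
theorem stmt_7 {n : ℕ} (U : Matrix (Fin n) (Fin n) ℝ)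
    (hU : ∀ i j, 0 ≤ U i j) (hns : IsUnit U.det)
    (hcol : ∀ i, 0 < ∑ j, U j i)
    (E : Matrix (Fin n) (Fin n) ℝ)
    (hE : E = Matrix.diagonal fun i => (∑ j, U j i)⁻¹) :
    IsPotential U ↔
      ∀ x : Fin n → ℝ, 0 ≤ ∑ i, max (U.mulVec x i - 1) 0 * E⁻¹.mulVec x i := by
  have hEinv : E⁻¹ = Matrix.diagonal fun i => ∑ j, U j i := by
    apply Matrix.inv_eq_right_inv
    rw [hE, Matrix.diagonal_mul_diagonal, ← Matrix.diagonal_one]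
    congr 1
    ext i
    exact inv_mul_cancel₀ (hcol i).ne'
  set M := E⁻¹ * U⁻¹ with hM
  have hMij : ∀ i j, M i j = (∑ k, U k i) * U⁻¹ i j := fun i j => by
    rw [hM, hEinv, Matrix.diagonal_mul]
  have hMcol : ∀ j, ∑ i, M i j = 1 := fun j => by
    simp only [hMij, Finset.sum_mul]
    rw [Finset.sum_comm]
    simp only [← Matrix.mul_apply, Matrix.mul_nonsing_inv U hns, Matrix.one_apply]
    simp
  have hMrow : ∀ i, ∑ j, M i j = (∑ k, U k i) * ∑ j, U⁻¹ i j := fun i => by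
    simp only [hMij, ← Finset.mul_sum]
  have hiff : (∀ x : Fin n → ℝ, 0 ≤ ∑ i, max (U.mulVec x i - 1) 0 * E⁻¹.mulVec x i) ↔
      ∀ y : Fin n → ℝ, 0 ≤ ∑ i, max (y i - 1) 0 * M.mulVec y i := by
    constructor
    · intro h y
      have := h (U⁻¹.mulVec y)
      rwa [Matrix.mulVec_mulVec, Matrix.mulVec_mulVec, Matrix.mul_nonsing_inv U hns,
        Matrix.one_mulVec] at this
    · intro h x
      have := h (U.mulVec x)
      rwa [Matrix.mulVec_mulVec, hM, Matrix.mul_assoc, Matrix.nonsing_inv_mul U hns,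
        Matrix.mul_one] at this
  rw [hiff]
  constructor
  · rintro ⟨-, -, hoff, -, hdom⟩
    refine sum_max_sub_one_mul_mulVec_nonneg M (fun i j hij => ?_) (fun i => ?_)
      (fun j => by rw [hMcol]; exact zero_le_one)
    · rw [hMij]
      exact mul_nonpos_of_nonneg_of_nonpos (hcol i).le (hoff i j hij)
    · rw [hMrow]
      refine mul_nonneg (hcol i).le ?_
      rw [← Finset.add_sum_erase _ _ (Finset.mem_univ i)]
      have h1 := Finset.abs_sum_le_sum_abs (U⁻¹ i) (Finset.univ.erase i)
      have h2 := neg_abs_le (∑ j ∈ Finset.univ.erase i, U⁻¹ i j)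
      linarith [hdom i]
  · intro h
    have hoff : ∀ i j, i ≠ j → U⁻¹ i j ≤ 0 := fun i j hij => by
      have := offDiag_nonpos_of_forall_sum_nonneg M h i j hij
      rw [hMij] at this
      exact nonpos_of_mul_nonpos_right this (hcol i)
    have hdom : ∀ i, ∑ j ∈ Finset.univ.erase i, |U⁻¹ i j| ≤ U⁻¹ i i := fun i => by
      have h1 := row_sum_nonneg_of_forall_sum_nonneg M h i
      rw [hMrow] at h1
      have h2 := nonneg_of_mul_nonneg_right h1 (hcol i)
      rw [← Finset.add_sum_erase _ _ (Finset.mem_univ i)] at h2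
      rw [Finset.sum_congr rfl fun j hj =>
        abs_of_nonpos (hoff i j (Finset.ne_of_mem_erase hj).symm), Finset.sum_neg_distrib]
      linarith
    refine ⟨hU, hns, hoff, fun i => ?_, hdom⟩
    have hnonneg := (Finset.sum_nonneg fun j _ => abs_nonneg (U⁻¹ i j)).trans (hdom i)
    refine lt_of_le_of_ne hnonneg fun h0 => ?_
    have hzero : ∀ j, U⁻¹ i j = 0 := fun j => by
      by_cases hj : j = i
      · rw [hj, ← h0]
      · have h1 := Finset.single_le_sum (f := fun j => |U⁻¹ i j|)
          (fun k _ => abs_nonneg _) (Finset.mem_erase.2 ⟨hj, Finset.mem_univ j⟩)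
        exact abs_nonpos_iff.1 (h1.trans ((hdom i).trans h0.symm.le))
    have h1 := congrFun (congrFun (Matrix.nonsing_inv_mul U hns) i) i
    simp [Matrix.mul_apply, hzero] at h1
end
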